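/- arXiv:2412.03207 — 2 statements merged into one kernel-verified Lean document; each statement's English description precedes it below -/
import Mathlib

section
/- Let φ(x) = Σ_{k=0}^∞ b_k x^k be an analytic function with convergence radius ρ, and let φ also denote the induced matrix function φ(X) = Σ_{k=0}^∞ b_k X^k (which converges whenever ‖X‖_* < ρ). Suppose the Assumption holds with ᾱ < ρ (there exists ᾱ ∈ (0,1), ᾱ < ρ, such that for all n and every i ∈ [n], α_i ≤ ᾱ), and that p ≫ log(n)/n. Then, for G ∼ G(n,p) and H = H(G), lim_{n→∞} ‖E(φ(H(G))) − φ(E(H(G)))‖_* = 0. -/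
open Finset Filter Topology Matrix

attribute [local instance] Classical.propDecidable

noncomputable section

/-- The set of possible edges of a simple undirected graph on `Fin n`:
all unordered pairs of distinct nodes. A graph `G ∈ 𝔾ₙ` is identified with its
edge set, a subset of `allEdges n`. -/
def allEdges (n : ℕ) : Finset (Sym2 (Fin n)) :=
  Finset.univ.filter fun e => ¬ e.IsDiag

/-- Probability weight of a given edge set in the Erdős–Rényi model `G(n,p)`. -/
def erProb (n : ℕ) (p : ℝ) (E : Finset (Sym2 (Fin n))) : ℝ :=
  p ^ E.card * (1 - p) ^ ((allEdges n).card - E.card)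

/-- Expectation of a real random variable in the Erdős–Rényi model `G(n,p)`. -/
def erExp (n : ℕ) (p : ℝ) (X : Finset (Sym2 (Fin n)) → ℝ) : ℝ :=
  ∑ E ∈ (allEdges n).powerset, erProb n p E * X E

/-- Degree of the node `i` in the graph with edge set `E`. -/
def deg (n : ℕ) (E : Finset (Sym2 (Fin n))) (i : Fin n) : ℕ :=
  (Finset.univ.filter fun j => j ≠ i ∧ s(i, j) ∈ E).card

/-- Truncated inverse degree `f_i`. -/
def finv (n : ℕ) (E : Finset (Sym2 (Fin n))) (i : Fin n) : ℝ :=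
  if deg n E i = 0 then 0 else 1 / (deg n E i : ℝ)

/-- The opinion-dynamics matrix `H(G)` with condescendence parameters `α`. -/
def Hmat (n : ℕ) (α : Fin n → ℝ) (E : Finset (Sym2 (Fin n))) : Matrix (Fin n) (Fin n) ℝ :=
  Matrix.of fun i j =>
    if deg n E i = 0 then (if i = j then α i else 0)
    else if i ≠ j ∧ s(i, j) ∈ E then α i / (deg n E i : ℝ) else 0

/-- Entrywise expectation of a random matrix in the Erdős–Rényi model `G(n,p)`. -/
def erExpMat (n : ℕ) (p : ℝ) (M : Finset (Sym2 (Fin n)) → Matrix (Fin n) (Fin n) ℝ) :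
    Matrix (Fin n) (Fin n) ℝ :=
  Matrix.of fun i j => erExp n p fun E => M E i j

/-- Conditional expectation `E(X | A)` given an event `A`. -/
def erCondExp (n : ℕ) (p : ℝ) (X : Finset (Sym2 (Fin n)) → ℝ)
    (A : Finset (Sym2 (Fin n)) → Prop) : ℝ :=
  erExp n p (fun E => if A E then X E else 0) / erExp n p (fun E => if A E then 1 else 0)

/-- The matrix norm `‖M‖_* = max_i Σ_j |M i j|` induced by the `ℓ∞` norm. -/
def starNorm {n : ℕ} (M : Matrix (Fin n) (Fin n) ℝ) : ℝ :=
  ⨆ i, ∑ j, |M i j|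

/-- The opinion-dynamics iterates `x(G,t)`: `x(G,0) = x0`,
`x(G,t+1) = H x(G,t) + B x0`. -/
def dyn (n : ℕ) (H B : Matrix (Fin n) (Fin n) ℝ) (x0 : Fin n → ℝ) : ℕ → Fin n → ℝ
  | 0 => x0
  | t + 1 => H *ᵥ dyn n H B x0 t + B *ᵥ x0

section ErdosRenyiExpectation

variable {n : ℕ} {p : ℝ}

lemma erProb_nonneg (hp : p ∈ Set.Ioo (0 : ℝ) 1) (E : Finset (Sym2 (Fin n))) :
    0 ≤ erProb n p E :=
  mul_nonneg (pow_nonneg hp.1.le _) (pow_nonneg (sub_nonneg.2 hp.2.le) _)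

lemma erExp_prod (f : Sym2 (Fin n) → ℝ) :
    erExp n p (fun E => ∏ e ∈ E, f e) = ∏ e ∈ allEdges n, (p * f e + (1 - p)) := by
  rw [Finset.prod_add]
  refine Finset.sum_congr rfl fun E hE => ?_
  rw [erProb, Finset.prod_mul_distrib, Finset.prod_const, Finset.prod_const,
    Finset.card_sdiff_of_subset (Finset.mem_powerset.1 hE)]
  ring

lemma erExp_one : erExp n p (fun _ => 1) = 1 := by
  have h := erExp_prod (n := n) (p := p) (fun _ => 1)
  simpa using h

lemma erExp_const_mul (c : ℝ) (X : Finset (Sym2 (Fin n)) → ℝ) :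
    erExp n p (fun E => c * X E) = c * erExp n p X := by
  rw [erExp, erExp, Finset.mul_sum]
  exact Finset.sum_congr rfl fun E _ => by ring

lemma erExp_const (c : ℝ) : erExp n p (fun _ => c) = c := by
  have h := erExp_const_mul (n := n) (p := p) c (fun _ => 1)
  simpa [erExp_one] using h

lemma erExp_add (X Y : Finset (Sym2 (Fin n)) → ℝ) :
    erExp n p (fun E => X E + Y E) = erExp n p X + erExp n p Y := by
  simp only [erExp, mul_add, Finset.sum_add_distrib]

lemma erExp_sub (X Y : Finset (Sym2 (Fin n)) → ℝ) :
    erExp n p (fun E => X E - Y E) = erExp n p X - erExp n p Y := by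
  simp only [erExp, mul_sub, Finset.sum_sub_distrib]

lemma erExp_sum {ι : Type*} (s : Finset ι) (X : ι → Finset (Sym2 (Fin n)) → ℝ) :
    erExp n p (fun E => ∑ i ∈ s, X i E) = ∑ i ∈ s, erExp n p (X i) := by
  simp only [erExp, Finset.mul_sum]
  exact Finset.sum_comm

lemma erExp_mono (hp : p ∈ Set.Ioo (0 : ℝ) 1) {X Y : Finset (Sym2 (Fin n)) → ℝ}
    (h : ∀ E, X E ≤ Y E) : erExp n p X ≤ erExp n p Y :=
  Finset.sum_le_sum fun E _ => mul_le_mul_of_nonneg_left (h E) (erProb_nonneg hp E)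

lemma abs_erExp_le (hp : p ∈ Set.Ioo (0 : ℝ) 1) (X : Finset (Sym2 (Fin n)) → ℝ) :
    |erExp n p X| ≤ erExp n p (fun E => |X E|) := by
  refine (Finset.abs_sum_le_sum_abs _ _).trans (Finset.sum_le_sum fun E _ => ?_)
  rw [abs_mul, abs_of_nonneg (erProb_nonneg hp E)]

lemma erExp_tsum (X : ℕ → Finset (Sym2 (Fin n)) → ℝ) (hX : ∀ E, Summable fun k => X k E) :
    HasSum (fun k => erExp n p (X k)) (erExp n p fun E => ∑' k, X k E) :=
  hasSum_sum fun E _ => (hX E).hasSum.mul_left _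

lemma erExpMat_mulVec (M : Finset (Sym2 (Fin n)) → Matrix (Fin n) (Fin n) ℝ) (x : Fin n → ℝ)
    (i : Fin n) : (erExpMat n p M *ᵥ x) i = erExp n p (fun E => (M E *ᵥ x) i) := by
  simp only [Matrix.mulVec, dotProduct, erExp_sum]
  refine Finset.sum_congr rfl fun j _ => ?_
  rw [mul_comm, erExpMat, Matrix.of_apply, ← erExp_const_mul]
  simp only [mul_comm]

/-- The neighbours of `v` in the graph with edge set `E`. -/
def nbrs (E : Finset (Sym2 (Fin n))) (v : Fin n) : Finset (Fin n) :=
  Finset.univ.filter fun j => j ≠ v ∧ s(v, j) ∈ E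

lemma erExp_exp_sum_nbrs_le (hp : p ∈ Set.Ioo (0 : ℝ) 1) (v : Fin n) (w : Fin n → ℝ) :
    erExp n p (fun E => Real.exp (∑ j ∈ nbrs E v, w j)) ≤
      Real.exp (p * ∑ j ∈ Finset.univ.erase v, (Real.exp (w j) - 1)) := by
  set g : Sym2 (Fin n) → ℝ := fun e => ∑ j, if j ≠ v ∧ s(v, j) = e then w j else 0 with hg
  have hinj : ∀ j j' : Fin n, s(v, j') = s(v, j) ↔ j' = j :=
    fun _ _ => Sym2.congr_right
  have hg_edge : ∀ j, j ≠ v → g s(v, j) = w j := by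
    intro j hj
    simp only [hg, hinj]
    rw [Finset.sum_eq_single j] <;> simp +contextual [hj]
  have hsum : ∀ E : Finset (Sym2 (Fin n)), ∑ j ∈ nbrs E v, w j = ∑ e ∈ E, g e := by
    intro E
    simp only [hg]
    rw [Finset.sum_comm, nbrs, Finset.sum_filter]
    refine Finset.sum_congr rfl fun j _ => ?_
    by_cases hj : j = v <;> simp [hj]
  simp only [hsum, Real.exp_sum]
  rw [erExp_prod]
  have himage : ∏ e ∈ allEdges n, (p * Real.exp (g e) + (1 - p)) =
      ∏ j ∈ Finset.univ.erase v, (p * Real.exp (w j) + (1 - p)) := by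
    have hsub : (Finset.univ.erase v).image (fun j => s(v, j)) ⊆ allEdges n := by
      intro e he
      obtain ⟨j, hj, rfl⟩ := Finset.mem_image.1 he
      simpa [allEdges, eq_comm] using hj
    rw [← Finset.prod_subset hsub, Finset.prod_image (fun a _ b _ h => (hinj b a).1 h)]
    · exact Finset.prod_congr rfl fun j hj => by rw [hg_edge j (Finset.ne_of_mem_erase hj)]
    · intro e _ he
      have hzero : g e = 0 := Finset.sum_eq_zero fun j _ => if_neg fun h =>
        he (Finset.mem_image.2 ⟨j, Finset.mem_erase.2 ⟨h.1, Finset.mem_univ j⟩, h.2⟩)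
      simp [hzero]
  rw [himage, Finset.mul_sum, Real.exp_sum]
  refine Finset.prod_le_prod (fun j _ => ?_) fun j _ => ?_
  · have := mul_pos hp.1 (Real.exp_pos (w j))
    linarith [hp.2]
  · have := Real.add_one_le_exp (p * (Real.exp (w j) - 1))
    linarith

lemma erExp_exp_sum_nbrs_le_of_sum_eq_zero (hp : p ∈ Set.Ioo (0 : ℝ) 1) (v : Fin n)
    {ε : ℝ} (hε : ε ∈ Set.Ioc (0 : ℝ) 1) (z : Fin n → ℝ) (hz : ∀ j, |z j| ≤ 2)
    (hz_sum : ∑ j ∈ Finset.univ.erase v, z j = 0) :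
    erExp n p (fun E => Real.exp (∑ j ∈ nbrs E v, ε / 18 * (z j - ε))) ≤
      Real.exp (-(((n - 1 : ℕ) : ℝ) * p * (ε ^ 2 / 36))) := by
  refine (erExp_exp_sum_nbrs_le hp v _).trans (Real.exp_le_exp.2 ?_)
  have hle : ∑ j ∈ Finset.univ.erase v, (Real.exp (ε / 18 * (z j - ε)) - 1) ≤
      ∑ j ∈ Finset.univ.erase v, (ε / 18 * z j - ε ^ 2 / 36) := by
    refine Finset.sum_le_sum fun j _ => ?_
    obtain ⟨hε0, hε1⟩ := hε
    obtain ⟨hz1, hz2⟩ := abs_le.1 (hz j)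
    have hsq : (z j - ε) ^ 2 ≤ 9 := by nlinarith
    have habs : |ε / 18 * (z j - ε)| ≤ 1 := by
      rw [abs_le]; constructor <;> nlinarith
    have h := (abs_le.1 (Real.abs_exp_sub_one_sub_id_le habs)).2
    have h' : (ε / 18 * (z j - ε)) ^ 2 ≤ (ε / 18) ^ 2 * 9 := by
      rw [mul_pow]; gcongr
    nlinarith
  have hrhs : ∑ j ∈ Finset.univ.erase v, (ε / 18 * z j - ε ^ 2 / 36) =
      -(((n - 1 : ℕ) : ℝ) * (ε ^ 2 / 36)) := by
    rw [Finset.sum_sub_distrib, ← Finset.mul_sum, hz_sum, Finset.sum_const,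
      Finset.card_erase_of_mem (Finset.mem_univ v), Finset.card_univ, Fintype.card_fin,
      nsmul_eq_mul, mul_zero, zero_sub]
  rw [hrhs] at hle
  nlinarith [mul_le_mul_of_nonneg_left hle hp.1.le]

end ErdosRenyiExpectation

section Substochastic

variable {n : ℕ}

/-- Nonnegative matrices whose row sums are at most `a`. -/
def RowSumLE (a : ℝ) (M : Matrix (Fin n) (Fin n) ℝ) : Prop :=
  (∀ i j, 0 ≤ M i j) ∧ ∀ i, ∑ j, M i j ≤ a

lemma RowSumLE.abs_mulVec_le {a : ℝ} {M : Matrix (Fin n) (Fin n) ℝ} (hM : RowSumLE a M)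
    {x : Fin n → ℝ} {c : ℝ} (hc : 0 ≤ c) (hx : ∀ j, |x j| ≤ c) (i : Fin n) :
    |(M *ᵥ x) i| ≤ a * c := by
  calc |(M *ᵥ x) i| ≤ ∑ j, |M i j * x j| :=
        Finset.abs_sum_le_sum_abs (fun j => M i j * x j) Finset.univ
    _ ≤ ∑ j, M i j * c := Finset.sum_le_sum fun j _ => by
        rw [abs_mul, abs_of_nonneg (hM.1 i j)]
        exact mul_le_mul_of_nonneg_left (hx j) (hM.1 i j)
    _ = (∑ j, M i j) * c := by rw [Finset.sum_mul]
    _ ≤ a * c := mul_le_mul_of_nonneg_right (hM.2 i) hc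

lemma RowSumLE.pow {a : ℝ} (ha : 0 ≤ a) {M : Matrix (Fin n) (Fin n) ℝ} (hM : RowSumLE a M)
    (k : ℕ) : RowSumLE (a ^ k) (M ^ k) := by
  induction k with
  | zero =>
    refine ⟨fun i j => ?_, fun i => ?_⟩
    · rw [pow_zero, Matrix.one_apply]; split_ifs <;> norm_num
    · simp [Matrix.one_apply]
  | succ k ih =>
    refine ⟨fun i j => ?_, fun i => ?_⟩
    · rw [pow_succ, Matrix.mul_apply]
      exact Finset.sum_nonneg fun l _ => mul_nonneg (ih.1 i l) (hM.1 l j)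
    · simp only [pow_succ, Matrix.mul_apply]
      rw [Finset.sum_comm]
      calc ∑ l, ∑ j, (M ^ k) i l * M l j = ∑ l, (M ^ k) i l * ∑ j, M l j := by
            simp only [Finset.mul_sum]
        _ ≤ ∑ l, (M ^ k) i l * a := Finset.sum_le_sum fun l _ =>
            mul_le_mul_of_nonneg_left (hM.2 l) (ih.1 i l)
        _ = (∑ l, (M ^ k) i l) * a := by rw [Finset.sum_mul]
        _ ≤ a ^ k * a := mul_le_mul_of_nonneg_right (ih.2 i) ha

lemma RowSumLE.abs_apply_le {a : ℝ} {M : Matrix (Fin n) (Fin n) ℝ} (hM : RowSumLE a M)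
    (i j : Fin n) : |M i j| ≤ a := by
  rw [abs_of_nonneg (hM.1 i j)]
  exact (Finset.single_le_sum (fun l _ => hM.1 i l) (Finset.mem_univ j)).trans (hM.2 i)

lemma RowSumLE.erExpMat {p a : ℝ} (hp : p ∈ Set.Ioo (0 : ℝ) 1)
    {M : Finset (Sym2 (Fin n)) → Matrix (Fin n) (Fin n) ℝ} (hM : ∀ E, RowSumLE a (M E)) :
    RowSumLE a (erExpMat n p M) := by
  refine ⟨fun i j => ?_, fun i => ?_⟩
  · exact (erExp_const (n := n) (p := p) 0).symm.le.trans (erExp_mono hp fun E => (hM E).1 i j)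
  · simp only [_root_.erExpMat, Matrix.of_apply]
    rw [← erExp_sum]
    exact (erExp_mono hp fun E => (hM E).2 i).trans (erExp_const a).le

lemma RowSumLE.summable_smul_pow {a : ℝ} (ha : 0 ≤ a) {M : Matrix (Fin n) (Fin n) ℝ}
    (hM : RowSumLE a M) {b : ℕ → ℝ} (hb : Summable fun k => |b k| * a ^ k) (i j : Fin n) :
    Summable fun k => b k * (M ^ k) i j := by
  refine Summable.of_norm_bounded hb fun k => ?_
  rw [Real.norm_eq_abs, abs_mul]
  exact mul_le_mul_of_nonneg_left ((hM.pow ha k).abs_apply_le i j) (abs_nonneg _)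

lemma RowSumLE.tsum_smul_pow_apply {a : ℝ} (ha : 0 ≤ a) {M : Matrix (Fin n) (Fin n) ℝ}
    (hM : RowSumLE a M) {b : ℕ → ℝ} (hb : Summable fun k => |b k| * a ^ k) (i j : Fin n) :
    (∑' k, b k • M ^ k) i j = ∑' k, b k * (M ^ k) i j := by
  have hs : Summable fun k => b k • M ^ k :=
    Pi.summable.2 fun i => Pi.summable.2 fun j => hM.summable_smul_pow ha hb i j
  have h := Pi.hasSum.1 (Pi.hasSum.1 hs.hasSum i) j
  exact h.tsum_eq.symm

lemma sum_abs_apply_le_of_abs_mulVec_le {M : Matrix (Fin n) (Fin n) ℝ} {c : ℝ} (i : Fin n)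
    (h : ∀ x : Fin n → ℝ, (∀ j, |x j| ≤ 1) → |(M *ᵥ x) i| ≤ c) : ∑ j, |M i j| ≤ c := by
  have hx := h (fun j => SignType.sign (M i j)) fun j => by
    rcases lt_trichotomy (M i j) 0 with hj | hj | hj <;> simp [hj]
  refine le_trans (le_trans (le_of_eq ?_) (le_abs_self _)) hx
  exact Finset.sum_congr rfl fun j _ => (self_mul_sign (M i j)).symm

end Substochastic

section Concentration

variable {n : ℕ} {p : ℝ}

lemma Hmat_nonneg {α : Fin n → ℝ} (hα : ∀ i, 0 ≤ α i) (E : Finset (Sym2 (Fin n)))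
    (i j : Fin n) : 0 ≤ Hmat n α E i j := by
  simp only [Hmat, Matrix.of_apply]
  split_ifs
  exacts [hα i, le_rfl, div_nonneg (hα i) (Nat.cast_nonneg _), le_rfl]

lemma Hmat_row_sum (α : Fin n → ℝ) (E : Finset (Sym2 (Fin n))) (i : Fin n) :
    ∑ j, Hmat n α E i j = α i := by
  simp only [Hmat, Matrix.of_apply]
  by_cases hd : deg n E i = 0
  · simp [hd]
  · simp only [hd, if_false]
    rw [← Finset.sum_filter, Finset.sum_const]
    have hcard : (Finset.univ.filter fun j => i ≠ j ∧ s(i, j) ∈ E).card = deg n E i := by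
      simp only [deg, ne_comm]
    rw [hcard, nsmul_eq_mul]
    field_simp

lemma Hmat_rowSumLE {α : Fin n → ℝ} {a : ℝ} (hα : ∀ i, 0 ≤ α i) (ha : ∀ i, α i ≤ a)
    (E : Finset (Sym2 (Fin n))) : RowSumLE a (Hmat n α E) :=
  ⟨Hmat_nonneg hα E, fun i => (Hmat_row_sum α E i).trans_le (ha i)⟩

lemma Hmat_mulVec_of_deg_ne_zero (α : Fin n → ℝ) {E : Finset (Sym2 (Fin n))} {v : Fin n}
    (hd : deg n E v ≠ 0) (y : Fin n → ℝ) :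
    (Hmat n α E *ᵥ y) v = α v / deg n E v * ∑ j ∈ nbrs E v, y j := by
  simp only [Matrix.mulVec, dotProduct, Hmat, Matrix.of_apply, hd, if_false, ite_mul, zero_mul]
  rw [nbrs, Finset.sum_filter, Finset.mul_sum]
  refine Finset.sum_congr rfl fun j _ => ?_
  simp only [ne_comm (a := v), mul_ite, mul_zero]

lemma exists_Hmat_mulVec_approx (hn : 2 ≤ n) (hp : p ∈ Set.Ioo (0 : ℝ) 1) {α : Fin n → ℝ}
    (hα : ∀ i, 0 ≤ α i) {ε : ℝ} (hε : ε ∈ Set.Ioc (0 : ℝ) 1) {y : Fin n → ℝ}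
    (hy : ∀ j, |y j| ≤ 1) (v : Fin n) :
    ∃ (m : ℝ) (W : Finset (Sym2 (Fin n)) → ℝ), (∀ E, 0 ≤ W E) ∧
      (∀ E, |(Hmat n α E *ᵥ y) v - α v * m| ≤ α v * (ε + 2 * W E)) ∧
      erExp n p W ≤ 2 * Real.exp (-(((n - 1 : ℕ) : ℝ) * p * (ε ^ 2 / 36))) := by
  have hN : (0 : ℝ) < ((n - 1 : ℕ) : ℝ) := by exact_mod_cast (by omega : 0 < n - 1)
  have hcard : ((Finset.univ.erase v).card : ℝ) = ((n - 1 : ℕ) : ℝ) := by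
    rw [Finset.card_erase_of_mem (Finset.mem_univ v), Finset.card_univ, Fintype.card_fin]
  set m : ℝ := (∑ j ∈ Finset.univ.erase v, y j) / ((n - 1 : ℕ) : ℝ) with hm
  have hm_abs : |m| ≤ 1 := by
    rw [hm, abs_div, abs_of_pos hN, div_le_one hN]
    refine (Finset.abs_sum_le_sum_abs _ _).trans ((Finset.sum_le_sum fun j _ => hy j).trans ?_)
    rw [Finset.sum_const, nsmul_eq_mul, hcard, mul_one]
  set z : Fin n → ℝ := fun j => y j - m with hz
  have hz_abs : ∀ j, |z j| ≤ 2 := fun j =>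
    (abs_sub _ _).trans (by linarith [hy j])
  have hz_sum : ∑ j ∈ Finset.univ.erase v, z j = 0 := by
    rw [hz, Finset.sum_sub_distrib, Finset.sum_const, nsmul_eq_mul, hcard, hm]
    field_simp
    ring
  set U : Finset (Sym2 (Fin n)) → ℝ := fun E => ∑ j ∈ nbrs E v, ε / 18 * (z j - ε) with hU
  set V : Finset (Sym2 (Fin n)) → ℝ := fun E => ∑ j ∈ nbrs E v, ε / 18 * (-z j - ε) with hV
  refine ⟨m, fun E => Real.exp (U E) + Real.exp (V E), fun E => by positivity, fun E => ?_, ?_⟩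
  · have hcrude : |(Hmat n α E *ᵥ y) v - α v * m| ≤ 2 * α v := by
      have hrow : |(Hmat n α E *ᵥ y) v| ≤ α v := by
        refine (Finset.abs_sum_le_sum_abs (fun j => Hmat n α E v j * y j) Finset.univ).trans ?_
        rw [← Hmat_row_sum α E v]
        refine Finset.sum_le_sum fun j _ => ?_
        rw [abs_mul, abs_of_nonneg (Hmat_nonneg hα E v j)]
        exact mul_le_of_le_one_right (Hmat_nonneg hα E v j) (hy j)
      refine (abs_sub _ _).trans ?_
      rw [abs_mul, abs_of_nonneg (hα v)]
      nlinarith [hα v]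
    by_cases hUV : 0 ≤ U E ∨ 0 ≤ V E
    · have hW : 1 ≤ Real.exp (U E) + Real.exp (V E) := by
        rcases hUV with h | h
        · linarith [Real.one_le_exp h, Real.exp_pos (V E)]
        · linarith [Real.one_le_exp h, Real.exp_pos (U E)]
      nlinarith [hα v, hε.1, mul_le_mul_of_nonneg_left hW (hα v), mul_nonneg (hα v) hε.1.le]
    · push Not at hUV
      have hdeg : ((nbrs E v).card : ℝ) = deg n E v := rfl
      simp only [hU, hV, ← Finset.mul_sum, Finset.sum_sub_distrib, Finset.sum_neg_distrib,
        Finset.sum_const, nsmul_eq_mul, hdeg] at hUV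
      have hpos : 0 < ε / 18 := by linarith [hε.1]
      obtain ⟨h1, h2⟩ := hUV
      have h1 := neg_of_mul_neg_right h1 hpos.le
      have h2 := neg_of_mul_neg_right h2 hpos.le
      have hd0 : deg n E v ≠ 0 := by
        intro h0
        have hempty : nbrs E v = ∅ := Finset.card_eq_zero.1 h0
        simp [h0, hempty] at h1
      have hd : (0 : ℝ) < deg n E v := by exact_mod_cast Nat.pos_of_ne_zero hd0
      have hdiff : (Hmat n α E *ᵥ y) v - α v * m =
          α v * ((∑ j ∈ nbrs E v, z j) / deg n E v) := by
        rw [Hmat_mulVec_of_deg_ne_zero α hd0, hz, Finset.sum_sub_distrib, Finset.sum_const,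
          nsmul_eq_mul, hdeg]
        field_simp
      rw [hdiff, abs_mul, abs_of_nonneg (hα v)]
      refine mul_le_mul_of_nonneg_left ?_ (hα v)
      have hratio : |(∑ j ∈ nbrs E v, z j) / deg n E v| ≤ ε := by
        rw [abs_div, abs_of_pos hd, div_le_iff₀ hd, abs_le]
        constructor <;> linarith
      linarith [Real.exp_pos (U E), Real.exp_pos (V E)]
  · rw [erExp_add, two_mul]
    exact add_le_add (erExp_exp_sum_nbrs_le_of_sum_eq_zero hp v hε z hz_abs hz_sum)
      (erExp_exp_sum_nbrs_le_of_sum_eq_zero hp v hε (fun j => -z j)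
        (fun j => (abs_neg (z j)).trans_le (hz_abs j)) (by simp [hz_sum]))

lemma exists_bound_Hmat_sub_erExpMat_mulVec (hn : 2 ≤ n) (hp : p ∈ Set.Ioo (0 : ℝ) 1)
    {α : Fin n → ℝ} {a : ℝ} (hα : ∀ i, 0 ≤ α i) (ha : ∀ i, α i ≤ a) (ha0 : 0 ≤ a)
    {ε : ℝ} (hε : ε ∈ Set.Ioc (0 : ℝ) 1)
    (hq : n * Real.exp (-(((n - 1 : ℕ) : ℝ) * p * (ε ^ 2 / 36))) ≤ ε) {y : Fin n → ℝ}
    (hy : ∀ j, |y j| ≤ 1) :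
    ∃ Z : Finset (Sym2 (Fin n)) → ℝ,
      (∀ E v, |(Hmat n α E *ᵥ y) v - (erExpMat n p (Hmat n α) *ᵥ y) v| ≤ Z E) ∧
      erExp n p Z ≤ a * (10 * ε) := by
  set q := Real.exp (-(((n - 1 : ℕ) : ℝ) * p * (ε ^ 2 / 36))) with hq_def
  have hq0 : 0 < q := Real.exp_pos _
  choose m W hW0 hW hWq using exists_Hmat_mulVec_approx hn hp hα hε hy
  have hqn : 2 * q ≤ ε := by
    have : (2 : ℝ) ≤ n := by exact_mod_cast hn
    nlinarith
  refine ⟨fun E => a * (4 * ε + 2 * ∑ v, W v E), fun E v => ?_, ?_⟩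
  · have hmean : |(erExpMat n p (Hmat n α) *ᵥ y) v - α v * m v| ≤ α v * (3 * ε) := by
      rw [erExpMat_mulVec, ← erExp_const (n := n) (p := p) (α v * m v), ← erExp_sub]
      refine (abs_erExp_le hp _).trans ((erExp_mono hp (hW v)).trans ?_)
      rw [erExp_const_mul, erExp_add, erExp_const, erExp_const_mul]
      exact mul_le_mul_of_nonneg_left (by linarith [hWq v]) (hα v)
    have hWle : W v E ≤ ∑ v, W v E :=
      Finset.single_le_sum (fun l _ => hW0 l E) (Finset.mem_univ v)
    calc |(Hmat n α E *ᵥ y) v - (erExpMat n p (Hmat n α) *ᵥ y) v|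
        ≤ |(Hmat n α E *ᵥ y) v - α v * m v| +
            |α v * m v - (erExpMat n p (Hmat n α) *ᵥ y) v| := abs_sub_le _ _ _
      _ ≤ α v * (4 * ε + 2 * ∑ v, W v E) := by
          rw [abs_sub_comm (α v * m v)]
          nlinarith [hW v E, mul_le_mul_of_nonneg_left hWle (hα v)]
      _ ≤ a * (4 * ε + 2 * ∑ v, W v E) := by
          refine mul_le_mul_of_nonneg_right (ha v) ?_
          linarith [hε.1, (hW0 v E).trans hWle]
  · rw [erExp_const_mul, erExp_add, erExp_const, erExp_const_mul, erExp_sum]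
    have hsum : ∑ v, erExp n p (W v) ≤ n * (2 * q) := by
      refine (Finset.sum_le_sum fun v _ => hWq v).trans (le_of_eq ?_)
      simp [← hq_def]
    exact mul_le_mul_of_nonneg_left (by linarith) ha0

end Concentration

section MeanField

variable {n : ℕ} {p : ℝ}

lemma abs_erExp_pow_mulVec_sub_le (hp : p ∈ Set.Ioo (0 : ℝ) 1) {a δ : ℝ} (ha : 0 < a)
    {M : Finset (Sym2 (Fin n)) → Matrix (Fin n) (Fin n) ℝ} (hM : ∀ E, RowSumLE a (M E))
    (hδ : ∀ x : Fin n → ℝ, (∀ j, |x j| ≤ 1) → ∃ Z : Finset (Sym2 (Fin n)) → ℝ,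
      (∀ E v, |(M E *ᵥ x) v - (erExpMat n p M *ᵥ x) v| ≤ Z E) ∧ erExp n p Z ≤ a * δ)
    (i : Fin n) (k : ℕ) (x : Fin n → ℝ) (hx : ∀ j, |x j| ≤ 1) :
    |erExp n p (fun E => (M E ^ k *ᵥ x) i) - (erExpMat n p M ^ k *ᵥ x) i| ≤
      k * a ^ k * δ := by
  induction k generalizing x with
  | zero => simp [erExp_const]
  | succ k ih =>
    obtain ⟨Z, hZ, hZδ⟩ := hδ x hx
    set N := erExpMat n p M with hN
    have hNa : RowSumLE a N := RowSumLE.erExpMat hp hM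
    have hsplit : erExp n p (fun E => (M E ^ (k + 1) *ᵥ x) i) - (N ^ (k + 1) *ᵥ x) i =
        erExp n p (fun E => (M E ^ k *ᵥ (M E *ᵥ x - N *ᵥ x)) i) +
        (erExp n p (fun E => (M E ^ k *ᵥ (N *ᵥ x)) i) - (N ^ k *ᵥ (N *ᵥ x)) i) := by
      rw [← add_sub_assoc, ← erExp_add]
      simp [pow_succ, Matrix.mulVec_sub, Matrix.mulVec_mulVec]
    have hfirst : |erExp n p (fun E => (M E ^ k *ᵥ (M E *ᵥ x - N *ᵥ x)) i)| ≤
        a ^ k * (a * δ) := by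
      refine (abs_erExp_le hp _).trans ?_
      refine (erExp_mono hp (Y := fun E => a ^ k * Z E) fun E => ?_).trans ?_
      · exact ((hM E).pow ha.le k).abs_mulVec_le ((abs_nonneg _).trans (hZ E i)) (hZ E) i
      · rw [erExp_const_mul]
        exact mul_le_mul_of_nonneg_left hZδ (pow_nonneg ha.le k)
    have hy : ∀ j, |(a⁻¹ • (N *ᵥ x)) j| ≤ 1 := fun j => by
      have := hNa.abs_mulVec_le zero_le_one hx j
      rw [Pi.smul_apply, smul_eq_mul, abs_mul, abs_of_pos (inv_pos.2 ha), inv_mul_le_iff₀ ha]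
      exact this
    have hsecond : |erExp n p (fun E => (M E ^ k *ᵥ (N *ᵥ x)) i) - (N ^ k *ᵥ (N *ᵥ x)) i| ≤
        a * (k * a ^ k * δ) := by
      have hxy : N *ᵥ x = a • (a⁻¹ • (N *ᵥ x)) := by rw [smul_smul, mul_inv_cancel₀ ha.ne', one_smul]
      have h := ih _ hy
      rw [hxy]
      generalize a⁻¹ • (N *ᵥ x) = y at h
      simp only [Matrix.mulVec_smul, Pi.smul_apply, smul_eq_mul]
      rw [erExp_const_mul, ← mul_sub, abs_mul, abs_of_pos ha]
      exact mul_le_mul_of_nonneg_left h ha.le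
    rw [hsplit]
    refine (abs_add_le _ _).trans ((add_le_add hfirst hsecond).trans (le_of_eq ?_))
    push_cast
    ring

lemma starNorm_erExpMat_tsum_sub_le [NeZero n] (hp : p ∈ Set.Ioo (0 : ℝ) 1) {a δ : ℝ} (ha : 0 < a)
    {M : Finset (Sym2 (Fin n)) → Matrix (Fin n) (Fin n) ℝ} (hM : ∀ E, RowSumLE a (M E))
    (hδ : ∀ x : Fin n → ℝ, (∀ j, |x j| ≤ 1) → ∃ Z : Finset (Sym2 (Fin n)) → ℝ,
      (∀ E v, |(M E *ᵥ x) v - (erExpMat n p M *ᵥ x) v| ≤ Z E) ∧ erExp n p Z ≤ a * δ)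
    {b : ℕ → ℝ} (hb : Summable fun k => |b k| * a ^ k)
    (hb' : Summable fun k => |b k| * (k * a ^ k)) :
    starNorm (erExpMat n p (fun E => ∑' k, b k • M E ^ k) - ∑' k, b k • erExpMat n p M ^ k) ≤
      (∑' k, |b k| * (k * a ^ k)) * δ := by
  set N := erExpMat n p M with hN
  have hNa : RowSumLE a N := RowSumLE.erExpMat hp hM
  refine ciSup_le fun i => sum_abs_apply_le_of_abs_mulVec_le i fun x hx => ?_
  have hentry : ∀ j, HasSum
      (fun k => b k * ((erExpMat n p (fun E => M E ^ k) i j - (N ^ k) i j) * x j))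
      ((erExpMat n p (fun E => ∑' k, b k • M E ^ k) - ∑' k, b k • N ^ k) i j * x j) := by
    intro j
    have h1 := erExp_tsum (p := p) (fun k E => b k * (M E ^ k) i j)
      fun E => (hM E).summable_smul_pow ha.le hb i j
    have h2 := (hNa.summable_smul_pow ha.le hb i j).hasSum
    have h3 := (h1.sub h2).mul_right (x j)
    rw [Matrix.sub_apply, hNa.tsum_smul_pow_apply ha.le hb, erExpMat, Matrix.of_apply]
    simp only [(hM _).tsum_smul_pow_apply ha.le hb]
    refine h3.congr_fun fun k => ?_
    rw [erExp_const_mul, erExpMat, Matrix.of_apply]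
    ring
  have hrow := hasSum_sum (s := Finset.univ) fun j _ => hentry j
  have hterm : ∀ k, |∑ j, b k * ((erExpMat n p (fun E => M E ^ k) i j - (N ^ k) i j) * x j)| ≤
      |b k| * (k * a ^ k) * δ := by
    intro k
    rw [← Finset.mul_sum, abs_mul, mul_assoc]
    refine mul_le_mul_of_nonneg_left ?_ (abs_nonneg _)
    have h := abs_erExp_pow_mulVec_sub_le hp ha hM hδ i k x hx
    rw [← erExpMat_mulVec] at h
    rw [← Pi.sub_apply, ← Matrix.sub_mulVec] at h
    exact h
  have hbound := (hb'.mul_right δ).hasSum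
  rw [tsum_mul_right] at hbound
  have h := tsum_of_norm_bounded hbound fun k => (Real.norm_eq_abs _).trans_le (hterm k)
  rwa [hrow.tsum_eq] at h

end MeanField

lemma summable_abs_mul_pow_and_of_summable {b : ℕ → ℝ} {a ρ : ℝ} (ha : 0 < a) (haρ : a < ρ)
    (hconv : ∀ x : ℝ, |x| < ρ → Summable fun k => b k * x ^ k) :
    (Summable fun k => |b k| * a ^ k) ∧ Summable fun k : ℕ => |b k| * (k * a ^ k) := by
  obtain ⟨r, har, hrρ⟩ := exists_between haρ
  have hr : 0 < r := ha.trans har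
  obtain ⟨C, hC⟩ := (hconv r (by rwa [abs_of_pos hr])).tendsto_atTop_zero.abs.bddAbove_range
  have hbC : ∀ k, |b k| * a ^ k ≤ C * (a / r) ^ k := fun k => by
    have h : |b k * r ^ k| ≤ C := hC ⟨k, rfl⟩
    rw [abs_mul, abs_of_pos (pow_pos hr k)] at h
    rw [div_pow, mul_div_assoc', le_div_iff₀ (pow_pos hr k)]
    nlinarith [mul_le_mul_of_nonneg_right h (pow_pos ha k).le]
  have hlt : a / r < 1 := (div_lt_one hr).2 har
  have hnorm : ‖a / r‖ < 1 := by rwa [Real.norm_eq_abs, abs_of_pos (div_pos ha hr)]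
  constructor
  · exact Summable.of_nonneg_of_le (fun k => by positivity) hbC
      ((summable_geometric_of_lt_one (div_pos ha hr).le hlt).mul_left C)
  · have hs := (summable_pow_mul_geometric_of_norm_lt_one 1 hnorm).mul_left C
    refine Summable.of_nonneg_of_le (fun k => by positivity) (fun k => ?_) hs
    have := mul_le_mul_of_nonneg_left (hbC k) (Nat.cast_nonneg (α := ℝ) k)
    rw [pow_one]
    linarith

lemma eventually_mul_exp_neg_le {p : ℕ → ℝ}
    (hreg : Tendsto (fun n : ℕ => p n / (Real.log n / n)) atTop atTop) {ε : ℝ} (hε : 0 < ε) :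
    ∀ᶠ n : ℕ in atTop,
      (n : ℝ) * Real.exp (-(((n - 1 : ℕ) : ℝ) * p n * (ε ^ 2 / 36))) ≤ ε := by
  have hinv : ∀ᶠ n : ℕ in atTop, (n : ℝ)⁻¹ ≤ ε :=
    (tendsto_inv_atTop_nhds_zero_nat (𝕜 := ℝ)).eventually_le_const hε
  filter_upwards [hreg.eventually_ge_atTop (144 / ε ^ 2), hinv, eventually_ge_atTop 2]
    with n hK hn_inv hn
  have hn2 : (2 : ℝ) ≤ n := by exact_mod_cast hn
  have hn0 : (0 : ℝ) < n := by linarith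
  have hlog : 0 < Real.log n := Real.log_pos (by linarith)
  rw [le_div_iff₀ (by positivity), ← mul_div_assoc, div_le_iff₀ hn0, div_mul_eq_mul_div,
    div_le_iff₀ (by positivity)] at hK
  have hexp : -(((n - 1 : ℕ) : ℝ) * p n * (ε ^ 2 / 36)) ≤ -(2 * Real.log n) := by
    rw [Nat.cast_sub (by omega), Nat.cast_one, neg_le_neg_iff]
    have hpos : 0 < p n * ε ^ 2 := by
      by_contra! h
      nlinarith
    nlinarith
  calc (n : ℝ) * Real.exp (-(((n - 1 : ℕ) : ℝ) * p n * (ε ^ 2 / 36)))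
      ≤ n * Real.exp (-(2 * Real.log n)) := by gcongr
    _ = (n : ℝ)⁻¹ := by
        rw [Real.exp_neg, two_mul, Real.exp_add, Real.exp_log hn0]
        field_simp
    _ ≤ ε := hn_inv

/-- **Theorem (mean-field approximation for analytic matrix functions).**
Let `φ(x) = Σ b_k x^k` be analytic with convergence radius `ρ` (the series
converges for every `|x| < ρ`), and let `φ(X) = Σ b_k X^k` denote the induced
matrix function (formalized as a `tsum`).  If the Assumption holds with
`ᾱ < ρ` and `p ≫ log n / n`, then for `G ∼ G(n,p)`,
`‖E(φ(H(G))) − φ(E(H(G)))‖_* → 0` as `n → ∞`. -/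
theorem mean_field_matrix_function
    (p : ℕ → ℝ) (hp : ∀ n, p n ∈ Set.Ioo (0 : ℝ) 1)
    (α : (n : ℕ) → Fin n → ℝ) (hα : ∀ n i, α n i ∈ Set.Icc (0 : ℝ) 1)
    (b : ℕ → ℝ) (ρ : ℝ) (hρ : 0 < ρ)
    (hconv : ∀ x : ℝ, |x| < ρ → Summable fun k => b k * x ^ k)
    (ᾱ : ℝ) (hᾱ : ᾱ ∈ Set.Ioo (0 : ℝ) 1) (hᾱρ : ᾱ < ρ)
    (hAssumption : ∀ n i, α n i ≤ ᾱ)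
    (hreg : Tendsto (fun n : ℕ => p n / (Real.log n / n)) atTop atTop) :
    Tendsto
      (fun n : ℕ =>
        starNorm
          (erExpMat n (p n) (fun E => ∑' k : ℕ, b k • Hmat n (α n) E ^ k) -
            ∑' k : ℕ, b k • erExpMat n (p n) (Hmat n (α n)) ^ k))
      atTop (nhds 0) := by
  obtain ⟨hb, hb'⟩ := summable_abs_mul_pow_and_of_summable hᾱ.1 hᾱρ hconv
  set C := ∑' k : ℕ, |b k| * (k * ᾱ ^ k) with hC
  have ha : 0 < ᾱ := hᾱ.1
  have hC0 : 0 ≤ C := tsum_nonneg fun k => by positivity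
  rw [Metric.tendsto_nhds]
  intro η hη
  set ε := min 1 (η / (10 * (C + 1)) / 2) with hε_def
  have hε : ε ∈ Set.Ioc (0 : ℝ) 1 := ⟨by positivity, min_le_left _ _⟩
  have hεη : C * (10 * ε) < η := by
    have h : ε ≤ η / (10 * (C + 1)) / 2 := min_le_right _ _
    rw [div_div, le_div_iff₀ (by positivity)] at h
    nlinarith [hε.1]
  filter_upwards [eventually_mul_exp_neg_le hreg hε.1, eventually_ge_atTop 2] with n hq hn
  have : NeZero n := ⟨by omega⟩
  have hα0 : ∀ i, 0 ≤ α n i := fun i => (hα n i).1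
  have hle := starNorm_erExpMat_tsum_sub_le (hp n) ha (Hmat_rowSumLE hα0 (hAssumption n))
    (fun x hx => exists_bound_Hmat_sub_erExpMat_mulVec hn (hp n) hα0 (hAssumption n) ha.le
      hε hq hx) hb hb'
  rw [Real.dist_eq, sub_zero, abs_of_nonneg]
  · exact hle.trans_lt hεη
  · exact Real.iSup_nonneg fun i => Finset.sum_nonneg fun j _ => abs_nonneg _
end
end

section
/- Let G ∼ D(n,p) be the directed Erdős–Rényi random graph with condescendence parameters α_i and initial opinions x(0) ∈ [0,1]^n. Suppose the Assumption holds (there exists ᾱ ∈ (0,1) such that for all n and every i ∈ [n], α_i ≤ ᾱ) and that p ≫ log(n)/n. Then ‖E(x(G,∞)) − x̄(∞)‖_∞ → 0 as n → ∞, where x(G,∞) is the stable opinion of the directed opinion dynamics on G and x̄(∞) = (I − E(H(G)))^{−1}Bx(0) is the stable solution of the mean-field dynamics. -/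
open Finset Filter Topology Matrix

attribute [local instance] Classical.propDecidable

noncomputable section

/-- The set of possible directed edges of a simple directed graph on `Fin n`:
all ordered pairs `(i,j)` with `i ≠ j`.  A directed graph `G ∈ 𝔻ₙ` is
identified with its edge set, a subset of `allDirEdges n`. -/
def allDirEdges (n : ℕ) : Finset (Fin n × Fin n) :=
  Finset.univ.filter fun e => e.1 ≠ e.2

/-- Probability weight of a given edge set in the directed Erdős–Rényi model
`D(n,p)`. -/
def dProb (n : ℕ) (p : ℝ) (E : Finset (Fin n × Fin n)) : ℝ :=
  p ^ E.card * (1 - p) ^ ((allDirEdges n).card - E.card)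

/-- Expectation of a real random variable in the directed Erdős–Rényi model
`D(n,p)`. -/
def dExp (n : ℕ) (p : ℝ) (X : Finset (Fin n × Fin n) → ℝ) : ℝ :=
  ∑ E ∈ (allDirEdges n).powerset, dProb n p E * X E

/-- Out-degree of the node `i` in the directed graph with edge set `E`. -/
def degPlus (n : ℕ) (E : Finset (Fin n × Fin n)) (i : Fin n) : ℕ :=
  (Finset.univ.filter fun j => j ≠ i ∧ (i, j) ∈ E).card

/-- Truncated inverse out-degree `f_i`. -/
def finvD (n : ℕ) (E : Finset (Fin n × Fin n)) (i : Fin n) : ℝ :=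
  if degPlus n E i = 0 then 0 else 1 / (degPlus n E i : ℝ)

/-- The opinion-dynamics matrix `H(G)` of a directed graph, with condescendence
parameters `α`. -/
def HmatD (n : ℕ) (α : Fin n → ℝ) (E : Finset (Fin n × Fin n)) : Matrix (Fin n) (Fin n) ℝ :=
  Matrix.of fun i j =>
    if degPlus n E i = 0 then (if i = j then α i else 0)
    else if i ≠ j ∧ (i, j) ∈ E then α i / (degPlus n E i : ℝ) else 0

/-- Entrywise expectation of a random matrix in the directed Erdős–Rényi model
`D(n,p)`. -/
def dExpMat (n : ℕ) (p : ℝ) (M : Finset (Fin n × Fin n) → Matrix (Fin n) (Fin n) ℝ) :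
    Matrix (Fin n) (Fin n) ℝ :=
  Matrix.of fun i j => dExp n p fun E => M E i j

/-- Conditional expectation `E(X | A)` given an event `A`. -/
def dCondExp (n : ℕ) (p : ℝ) (X : Finset (Fin n × Fin n) → ℝ)
    (A : Finset (Fin n × Fin n) → Prop) : ℝ :=
  dExp n p (fun E => if A E then X E else 0) / dExp n p (fun E => if A E then 1 else 0)

/-- The opinion-dynamics iterates `x(G,t)`: `x(G,0) = x0`,
`x(G,t+1) = H x(G,t) + B x0`. -/
def dynD (n : ℕ) (H B : Matrix (Fin n) (Fin n) ℝ) (x0 : Fin n → ℝ) : ℕ → Fin n → ℝ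
  | 0 => x0
  | t + 1 => H *ᵥ dynD n H B x0 t + B *ᵥ x0

section Contraction

variable {n : ℕ} {A : Matrix (Fin n) (Fin n) ℝ} {a : ℝ}

lemma norm_mulVec_le_of_row_sum_le (ha : 0 ≤ a) (hA : ∀ i, ∑ j, |A i j| ≤ a)
    (v : Fin n → ℝ) : ‖A *ᵥ v‖ ≤ a * ‖v‖ := by
  refine (pi_norm_le_iff_of_nonneg (by positivity)).2 fun i => ?_
  rw [Real.norm_eq_abs, Matrix.mulVec, dotProduct]
  calc |∑ j, A i j * v j| ≤ ∑ j, |A i j * v j| := Finset.abs_sum_le_sum_abs _ _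
    _ ≤ ∑ j, |A i j| * ‖v‖ := by
        refine Finset.sum_le_sum fun j _ => ?_
        rw [abs_mul]
        exact mul_le_mul_of_nonneg_left (norm_le_pi_norm v j) (abs_nonneg _)
    _ = (∑ j, |A i j|) * ‖v‖ := by rw [Finset.sum_mul]
    _ ≤ a * ‖v‖ := mul_le_mul_of_nonneg_right (hA i) (norm_nonneg _)

lemma norm_le_of_eq_mulVec_add (ha : 0 ≤ a) (ha1 : a < 1) (hA : ∀ i, ∑ j, |A i j| ≤ a)
    {v b : Fin n → ℝ} (h : v = A *ᵥ v + b) : ‖v‖ ≤ ‖b‖ / (1 - a) := by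
  rw [le_div_iff₀ (by linarith)]
  have h1 : ‖v‖ ≤ ‖A *ᵥ v‖ + ‖b‖ := by
    conv_lhs => rw [h]
    exact norm_add_le _ _
  have h2 := norm_mulVec_le_of_row_sum_le ha hA v
  linarith

lemma inv_one_sub_mulVec_eq (ha : 0 ≤ a) (ha1 : a < 1) (hA : ∀ i, ∑ j, |A i j| ≤ a)
    (b : Fin n → ℝ) :
    (1 - A)⁻¹ *ᵥ b = A *ᵥ ((1 - A)⁻¹ *ᵥ b) + b := by
  have hu : IsUnit (1 - A) := by
    rw [← Matrix.mulVec_injective_iff_isUnit]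
    intro v w hvw
    have h : v - w = A *ᵥ (v - w) + 0 := by
      have : (1 - A) *ᵥ (v - w) = 0 := by
        rw [Matrix.mulVec_sub]
        exact sub_eq_zero.2 hvw
      rw [Matrix.sub_mulVec, Matrix.one_mulVec, sub_eq_zero] at this
      rwa [add_zero]
    have h0 := norm_le_of_eq_mulVec_add ha ha1 hA h
    rw [norm_zero, zero_div] at h0
    exact sub_eq_zero.1 (norm_le_zero_iff.1 h0)
  have h : (1 - A) *ᵥ ((1 - A)⁻¹ *ᵥ b) = b := by
    rw [Matrix.mulVec_mulVec, Matrix.mul_nonsing_inv _ ((Matrix.isUnit_iff_isUnit_det _).1 hu),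
      Matrix.one_mulVec]
  rw [Matrix.sub_mulVec, Matrix.one_mulVec] at h
  exact sub_eq_iff_eq_add'.1 h

lemma tendsto_dynD (ha : 0 ≤ a) (ha1 : a < 1) (hA : ∀ i, ∑ j, |A i j| ≤ a)
    {B : Matrix (Fin n) (Fin n) ℝ} {x v : Fin n → ℝ} (hv : v = A *ᵥ v + B *ᵥ x) :
    Tendsto (dynD n A B x) atTop (𝓝 v) := by
  rw [tendsto_iff_norm_sub_tendsto_zero]
  have hbound : ∀ t, ‖dynD n A B x t - v‖ ≤ a ^ t * ‖x - v‖ := by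
    intro t
    induction t with
    | zero => simp [dynD]
    | succ t ih =>
      have h : dynD n A B x (t + 1) - v = A *ᵥ (dynD n A B x t - v) := by
        conv_lhs => rw [hv]
        rw [dynD, Matrix.mulVec_sub]
        abel
      rw [h]
      calc _ ≤ a * ‖dynD n A B x t - v‖ := norm_mulVec_le_of_row_sum_le ha hA _
        _ ≤ a * (a ^ t * ‖x - v‖) := mul_le_mul_of_nonneg_left ih ha
        _ = a ^ (t + 1) * ‖x - v‖ := by ring
  refine squeeze_zero (fun _ => norm_nonneg _) hbound ?_
  simpa using (tendsto_pow_atTop_nhds_zero_of_lt_one ha ha1).mul_const ‖x - v‖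

lemma norm_sub_le_of_fixed_points (ha : 0 ≤ a) (ha1 : a < 1) (hA : ∀ i, ∑ j, |A i j| ≤ a)
    {M : Matrix (Fin n) (Fin n) ℝ} {v w b : Fin n → ℝ} (hv : v = A *ᵥ v + b)
    (hw : w = M *ᵥ w + b) : ‖v - w‖ ≤ ‖(A - M) *ᵥ w‖ / (1 - a) := by
  refine norm_le_of_eq_mulVec_add ha ha1 hA ?_
  conv_lhs => rw [hv, hw]
  rw [Matrix.mulVec_sub, Matrix.sub_mulVec]
  abel

end Contraction

section Expectation

variable {n : ℕ} {p : ℝ}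

lemma dProb_nonneg (hp : p ∈ Set.Ioo (0 : ℝ) 1) (E : Finset (Fin n × Fin n)) :
    0 ≤ dProb n p E :=
  mul_nonneg (pow_nonneg hp.1.le _) (pow_nonneg (sub_nonneg.2 hp.2.le) _)

lemma dExp_mono (hp : p ∈ Set.Ioo (0 : ℝ) 1) {X Y : Finset (Fin n × Fin n) → ℝ}
    (h : ∀ E ∈ (allDirEdges n).powerset, X E ≤ Y E) : dExp n p X ≤ dExp n p Y :=
  Finset.sum_le_sum fun E hE => mul_le_mul_of_nonneg_left (h E hE) (dProb_nonneg hp E)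

lemma dExp_add (X Y : Finset (Fin n × Fin n) → ℝ) :
    dExp n p (fun E => X E + Y E) = dExp n p X + dExp n p Y := by
  simp only [dExp, mul_add, Finset.sum_add_distrib]

lemma dExp_sub (X Y : Finset (Fin n × Fin n) → ℝ) :
    dExp n p (fun E => X E - Y E) = dExp n p X - dExp n p Y := by
  simp only [dExp, mul_sub, Finset.sum_sub_distrib]

lemma dExp_mul_const (X : Finset (Fin n × Fin n) → ℝ) (c : ℝ) :
    dExp n p (fun E => X E * c) = dExp n p X * c := by
  simp only [dExp, Finset.sum_mul, mul_assoc]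

lemma dExp_sum {ι : Type*} (s : Finset ι) (X : ι → Finset (Fin n × Fin n) → ℝ) :
    dExp n p (fun E => ∑ k ∈ s, X k E) = ∑ k ∈ s, dExp n p (X k) := by
  simp only [dExp, Finset.mul_sum]
  exact Finset.sum_comm

lemma dExp_prod (w : Fin n × Fin n → ℝ) :
    dExp n p (fun E => ∏ e ∈ E, w e) = ∏ e ∈ allDirEdges n, (p * w e + (1 - p)) := by
  rw [Finset.prod_add, dExp]
  refine Finset.sum_congr rfl fun E hE => ?_
  rw [Finset.prod_mul_distrib, Finset.prod_const, Finset.prod_const,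
    Finset.card_sdiff_of_subset (Finset.mem_powerset.1 hE), dProb]
  ring

lemma dExp_const (c : ℝ) : dExp n p (fun _ => c) = c := by
  have h := dExp_prod (n := n) (p := p) fun _ => 1
  have h2 := dExp_mul_const (n := n) (p := p) (fun _ => 1) c
  simp only [Finset.prod_const_one, mul_one, add_sub_cancel] at h
  simpa [h] using h2

lemma abs_dExp_le (hp : p ∈ Set.Ioo (0 : ℝ) 1) (X : Finset (Fin n × Fin n) → ℝ) :
    |dExp n p X| ≤ dExp n p fun E => |X E| := by
  refine (Finset.abs_sum_le_sum_abs _ _).trans_eq ?_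
  exact Finset.sum_congr rfl fun E _ => by rw [abs_mul, abs_of_nonneg (dProb_nonneg hp E)]

lemma norm_dExp_le (hp : p ∈ Set.Ioo (0 : ℝ) 1) (X : Finset (Fin n × Fin n) → Fin n → ℝ) :
    ‖fun i => dExp n p fun E => X E i‖ ≤ dExp n p fun E => ‖X E‖ := by
  have h0 : 0 ≤ dExp n p fun E => ‖X E‖ := by
    simpa [dExp_const] using dExp_mono (n := n) (X := fun _ => 0) (Y := fun E => ‖X E‖) hp
      fun E _ => norm_nonneg _
  refine (pi_norm_le_iff_of_nonneg h0).2 fun i => ?_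
  exact (abs_dExp_le hp _).trans (dExp_mono hp fun E _ => norm_le_pi_norm (X E) i)

end Expectation

/-- Out-neighbours of `i` in the directed graph with edge set `E`. -/
def outNbrs (n : ℕ) (E : Finset (Fin n × Fin n)) (i : Fin n) : Finset (Fin n) :=
  Finset.univ.filter fun j => j ≠ i ∧ (i, j) ∈ E

section Rows

variable {n : ℕ} {p a : ℝ} {α : Fin n → ℝ}

lemma card_outNbrs (E : Finset (Fin n × Fin n)) (i : Fin n) :
    (outNbrs n E i).card = degPlus n E i := rfl

lemma HmatD_mulVec (E : Finset (Fin n × Fin n)) (v : Fin n → ℝ) (i : Fin n) :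
    (HmatD n α E *ᵥ v) i =
      if degPlus n E i = 0 then α i * v i
      else α i * ((∑ j ∈ outNbrs n E i, v j) / degPlus n E i) := by
  simp only [HmatD, Matrix.mulVec, dotProduct, Matrix.of_apply]
  split_ifs with h
  · simp
  · rw [outNbrs, Finset.sum_filter, Finset.sum_div, Finset.mul_sum]
    refine Finset.sum_congr rfl fun j _ => ?_
    by_cases hj : i ≠ j ∧ (i, j) ∈ E
    · rw [if_pos hj, if_pos ⟨hj.1.symm, hj.2⟩]
      ring
    · rw [if_neg hj, if_neg fun h' => hj ⟨h'.1.symm, h'.2⟩]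
      ring

lemma HmatD_row_sum_le (h0 : ∀ i, 0 ≤ α i) (h1 : ∀ i, α i ≤ a)
    (E : Finset (Fin n × Fin n)) (i : Fin n) : ∑ j, |HmatD n α E i j| ≤ a := by
  have habs : ∀ j, |HmatD n α E i j| = HmatD n α E i j * 1 := by
    intro j
    rw [mul_one, abs_of_nonneg]
    have := h0 i
    simp only [HmatD, Matrix.of_apply]
    split_ifs <;> positivity
  have h : ∑ j, |HmatD n α E i j| = (HmatD n α E *ᵥ fun _ => 1) i :=
    Finset.sum_congr rfl fun j _ => habs j
  rw [h, HmatD_mulVec]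
  split_ifs with hd
  · simpa using h1 i
  · have : (degPlus n E i : ℝ) ≠ 0 := Nat.cast_ne_zero.2 hd
    simpa [card_outNbrs, this] using h1 i

lemma dExpMat_row_sum_le (hp : p ∈ Set.Ioo (0 : ℝ) 1)
    {M : Finset (Fin n × Fin n) → Matrix (Fin n) (Fin n) ℝ}
    (hM : ∀ E i, ∑ j, |M E i j| ≤ a) (i : Fin n) : ∑ j, |dExpMat n p M i j| ≤ a :=
  calc ∑ j, |dExpMat n p M i j| ≤ ∑ j, dExp n p fun E => |M E i j| :=
        Finset.sum_le_sum fun _ _ => abs_dExp_le hp _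
    _ = dExp n p fun E => ∑ j, |M E i j| := (dExp_sum _ _).symm
    _ ≤ dExp n p fun _ => a := dExp_mono hp fun E _ => hM E i
    _ = a := dExp_const a

lemma dExpMat_mulVec (M : Finset (Fin n × Fin n) → Matrix (Fin n) (Fin n) ℝ)
    (v : Fin n → ℝ) : dExpMat n p M *ᵥ v = fun i => dExp n p fun E => (M E *ᵥ v) i := by
  ext i
  simp only [Matrix.mulVec, dotProduct, dExpMat, Matrix.of_apply, dExp_sum, dExp_mul_const]

end Rows

/-- The opinion-dynamics matrix of the complete graph. -/
def completeMat (n : ℕ) (α : Fin n → ℝ) : Matrix (Fin n) (Fin n) ℝ :=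
  Matrix.of fun i j => if j ∈ Finset.univ.erase i then α i / (n - 1 : ℝ) else 0

section Complete

variable {n : ℕ} {a : ℝ} {α : Fin n → ℝ}

lemma completeMat_mulVec (v : Fin n → ℝ) (i : Fin n) :
    (completeMat n α *ᵥ v) i = α i * ((∑ j ∈ Finset.univ.erase i, v j) / (n - 1 : ℝ)) := by
  simp only [completeMat, Matrix.mulVec, dotProduct, Matrix.of_apply, ite_mul, zero_mul]
  rw [Finset.sum_ite_mem, Finset.univ_inter, Finset.sum_div, Finset.mul_sum]
  exact Finset.sum_congr rfl fun j _ => by ring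

lemma card_univ_erase_cast (i : Fin n) :
    (((Finset.univ.erase i).card : ℕ) : ℝ) = n - 1 := by
  rw [Finset.card_erase_of_mem (Finset.mem_univ i), Finset.card_univ, Fintype.card_fin,
    Nat.cast_pred i.pos]

lemma completeMat_row_sum_le (hn : 2 ≤ n) (h0 : ∀ i, 0 ≤ α i) (h1 : ∀ i, α i ≤ a)
    (i : Fin n) : ∑ j, |completeMat n α i j| ≤ a := by
  have hn1 : (0 : ℝ) < n - 1 := by
    have : (2 : ℝ) ≤ n := by exact_mod_cast hn
    linarith
  have h : ∑ j, |completeMat n α i j| = (completeMat n α *ᵥ fun _ => 1) i := by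
    refine Finset.sum_congr rfl fun j _ => ?_
    rw [mul_one, abs_of_nonneg]
    have := h0 i
    simp only [completeMat, Matrix.of_apply]
    split_ifs <;> positivity
  rw [h, completeMat_mulVec]
  simp only [Finset.sum_const, nsmul_eq_mul, mul_one, card_univ_erase_cast]
  rw [div_self hn1.ne', mul_one]
  exact h1 i

end Complete

section Concentration

variable {n : ℕ} {p : ℝ}

lemma prod_edges_eq_exp_sum_outNbrs {E : Finset (Fin n × Fin n)} (hE : E ⊆ allDirEdges n)
    (i : Fin n) (f : Fin n → ℝ) :
    ∏ e ∈ E, (if e.1 = i then Real.exp (f e.2) else 1) =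
      Real.exp (∑ j ∈ outNbrs n E i, f j) := by
  rw [Real.exp_sum, ← Finset.prod_filter]
  refine Finset.prod_nbij' (fun e => e.2) (fun j => (i, j)) ?_ ?_ ?_ ?_ ?_
  · rintro ⟨k, j⟩ he
    obtain ⟨heE, rfl⟩ := Finset.mem_filter.1 he
    have := (Finset.mem_filter.1 (hE heE)).2
    exact Finset.mem_filter.2 ⟨Finset.mem_univ _, Ne.symm this, heE⟩
  · intro j hj
    exact Finset.mem_filter.2 ⟨(Finset.mem_filter.1 hj).2.2, rfl⟩
  · rintro ⟨k, j⟩ he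
    obtain ⟨_, rfl⟩ := Finset.mem_filter.1 he
    rfl
  · intro j _
    rfl
  · intro e _
    rfl

lemma outNbrs_allDirEdges (i : Fin n) : outNbrs n (allDirEdges n) i = Finset.univ.erase i := by
  ext j
  simp [outNbrs, allDirEdges, eq_comm]

/-- Chernoff bound for a sum of centred weights, shifted by `-ε`, over the out-neighbours. -/
lemma dExp_sum_outNbrs_nonneg_le (hp : p ∈ Set.Ioo (0 : ℝ) 1) (i : Fin n) {c : Fin n → ℝ}
    {L ε : ℝ} (hL : 0 ≤ L) (hε : 0 < ε) (hc : ∀ j, |c j| ≤ L)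
    (hsum : ∑ j ∈ Finset.univ.erase i, c j = 0) :
    dExp n p (fun E => if 0 ≤ ∑ j ∈ outNbrs n E i, (c j - ε) then 1 else 0) ≤
      Real.exp (-(p * (n - 1 : ℝ) * (ε ^ 2 / (4 * (L + ε) ^ 2)))) := by
  set K := L + ε with hK
  have hK0 : 0 < K := by linarith
  set l := ε / (2 * K ^ 2) with hl
  have hl0 : 0 < l := by positivity
  have hlK : l * K ≤ 1 := by
    have : l * K = ε / (2 * K) := by rw [hl]; field_simp
    rw [this, div_le_one (by linarith)]
    linarith
  set f : Fin n → ℝ := fun j => l * (c j - ε) with hf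
  set w : Fin n × Fin n → ℝ := fun e => if e.1 = i then Real.exp (f e.2) else 1 with hw
  have hexp : ∀ j, Real.exp (f j) - 1 ≤ f j + (l * K) ^ 2 := by
    intro j
    have hcK : |c j - ε| ≤ K := by
      have := abs_le.1 (hc j)
      rw [abs_le]
      constructor <;> linarith
    have hfj : |f j| ≤ l * K := by
      rw [hf, abs_mul, abs_of_pos hl0]
      exact mul_le_mul_of_nonneg_left hcK hl0.le
    have h1 := (abs_le.1 (Real.abs_exp_sub_one_sub_id_le (hfj.trans hlK))).2
    have h2 : f j ^ 2 ≤ (l * K) ^ 2 := sq_le_sq.2 (by rwa [abs_of_pos (mul_pos hl0 hK0)])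
    linarith
  calc dExp n p (fun E => if 0 ≤ ∑ j ∈ outNbrs n E i, (c j - ε) then 1 else 0)
      ≤ dExp n p (fun E => ∏ e ∈ E, w e) := by
        refine dExp_mono hp fun E hE => ?_
        rw [prod_edges_eq_exp_sum_outNbrs (Finset.mem_powerset.1 hE), hf, ← Finset.mul_sum]
        split_ifs with h
        · exact Real.one_le_exp (mul_nonneg hl0.le h)
        · exact (Real.exp_pos _).le
    _ = ∏ e ∈ allDirEdges n, (p * w e + (1 - p)) := dExp_prod w
    _ ≤ ∏ e ∈ allDirEdges n,
          (if e.1 = i then Real.exp (p * (Real.exp (f e.2) - 1)) else 1) := by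
        refine Finset.prod_le_prod (fun e _ => ?_) fun e _ => ?_
        · have h1 : 0 ≤ w e := by
            simp only [hw]
            split_ifs <;> positivity
          exact add_nonneg (mul_nonneg hp.1.le h1) (sub_nonneg.2 hp.2.le)
        · simp only [hw]
          split_ifs
          · have := Real.add_one_le_exp (p * (Real.exp (f e.2) - 1))
            linarith
          · linarith
    _ = Real.exp (∑ j ∈ Finset.univ.erase i, p * (Real.exp (f j) - 1)) := by
        rw [← outNbrs_allDirEdges]
        exact prod_edges_eq_exp_sum_outNbrs subset_rfl i fun j => p * (Real.exp (f j) - 1)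
    _ ≤ Real.exp (∑ j ∈ Finset.univ.erase i, p * (f j + (l * K) ^ 2)) :=
        Real.exp_le_exp.2 (Finset.sum_le_sum fun j _ =>
          mul_le_mul_of_nonneg_left (hexp j) hp.1.le)
    _ = _ := by
        rw [← Finset.mul_sum, Finset.sum_add_distrib, hf, ← Finset.mul_sum,
          Finset.sum_sub_distrib, hsum, Finset.sum_const, Finset.sum_const, nsmul_eq_mul,
          nsmul_eq_mul, card_univ_erase_cast, hl]
        congr 1
        field_simp
        ring

lemma abs_HmatD_sub_completeMat_mulVec_le (hn : 2 ≤ n) {α : Fin n → ℝ}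
    (hα : ∀ i, α i ∈ Set.Icc (0 : ℝ) 1) {y : Fin n → ℝ} {C ε : ℝ} (hε : 0 < ε)
    (hC : ∀ j, |y j| ≤ C) (E : Finset (Fin n × Fin n)) (i : Fin n) {m : ℝ}
    (hm : m = (∑ j ∈ Finset.univ.erase i, y j) / (n - 1 : ℝ)) :
    |((HmatD n α E - completeMat n α) *ᵥ y) i| ≤
      ε + 2 * C * ((if 0 ≤ ∑ j ∈ outNbrs n E i, ((y j - m) - ε) then 1 else 0) +
        (if 0 ≤ ∑ j ∈ outNbrs n E i, (-(y j - m) - ε) then 1 else 0)) := by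
  have hC0 : 0 ≤ C := (abs_nonneg _).trans (hC i)
  have hα1 : ∀ j, |α j| ≤ 1 := fun j => abs_le.2 ⟨by linarith [(hα j).1], (hα j).2⟩
  have hbd : |((HmatD n α E - completeMat n α) *ᵥ y) i| ≤ 2 * C := by
    have hy : ‖y‖ ≤ C := (pi_norm_le_iff_of_nonneg hC0).2 hC
    have h1 := norm_mulVec_le_of_row_sum_le zero_le_one
      (HmatD_row_sum_le (fun j => (hα j).1) (fun j => (hα j).2) E) y
    have h2 := norm_mulVec_le_of_row_sum_le zero_le_one
      (completeMat_row_sum_le hn (fun j => (hα j).1) (fun j => (hα j).2)) y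
    refine (norm_le_pi_norm ((HmatD n α E - completeMat n α) *ᵥ y) i).trans ?_
    rw [Matrix.sub_mulVec]
    refine (norm_sub_le _ _).trans ?_
    linarith
  by_cases hA : 0 ≤ ∑ j ∈ outNbrs n E i, ((y j - m) - ε)
  · rw [if_pos hA]
    split_ifs
    · linarith
    · linarith
  by_cases hB : 0 ≤ ∑ j ∈ outNbrs n E i, (-(y j - m) - ε)
  · rw [if_neg hA, if_pos hB]
    linarith
  rw [if_neg hA, if_neg hB]
  have hd : degPlus n E i ≠ 0 := by
    intro h
    rw [← card_outNbrs, Finset.card_eq_zero] at h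
    simp [h] at hA
  have hd0 : (0 : ℝ) < degPlus n E i := Nat.cast_pos.2 (Nat.pos_of_ne_zero hd)
  simp only [Finset.sum_sub_distrib, Finset.sum_neg_distrib, Finset.sum_const, nsmul_eq_mul,
    card_outNbrs, not_le] at hA hB
  have h : ((HmatD n α E - completeMat n α) *ᵥ y) i =
      α i * ((∑ j ∈ outNbrs n E i, y j) / degPlus n E i - m) := by
    rw [Matrix.sub_mulVec, Pi.sub_apply, HmatD_mulVec, completeMat_mulVec, if_neg hd, ← hm]
    ring
  have h2 : |(∑ j ∈ outNbrs n E i, y j) / degPlus n E i - m| ≤ ε := by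
    rw [abs_le]
    constructor
    · rw [le_sub_iff_add_le, le_div_iff₀ hd0]
      linarith
    · rw [sub_le_iff_le_add, div_le_iff₀ hd0]
      linarith
  rw [h, abs_mul]
  have h3 := mul_le_mul (hα1 i) h2 (abs_nonneg _) zero_le_one
  linarith

lemma dExp_norm_HmatD_sub_completeMat_mulVec_le (hn : 2 ≤ n) (hp : p ∈ Set.Ioo (0 : ℝ) 1)
    {α : Fin n → ℝ} (hα : ∀ i, α i ∈ Set.Icc (0 : ℝ) 1) {y : Fin n → ℝ} {C ε : ℝ}
    (hC0 : 0 ≤ C) (hε : 0 < ε) (hC : ‖y‖ ≤ C) :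
    dExp n p (fun E => ‖(HmatD n α E - completeMat n α) *ᵥ y‖) ≤
      ε + 4 * C * (n * Real.exp (-(p * (n - 1 : ℝ) * (ε ^ 2 / (4 * (2 * C + ε) ^ 2))))) := by
  have hn1 : (0 : ℝ) < n - 1 := by
    have : (2 : ℝ) ≤ n := by exact_mod_cast hn
    linarith
  have hyC : ∀ j, |y j| ≤ C := fun j => (norm_le_pi_norm y j).trans hC
  set m : Fin n → ℝ := fun i => (∑ j ∈ Finset.univ.erase i, y j) / (n - 1 : ℝ) with hm
  set P : Fin n → Finset (Fin n × Fin n) → ℝ := fun i E =>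
    if 0 ≤ ∑ j ∈ outNbrs n E i, ((y j - m i) - ε) then 1 else 0 with hP
  set Q : Fin n → Finset (Fin n × Fin n) → ℝ := fun i E =>
    if 0 ≤ ∑ j ∈ outNbrs n E i, (-(y j - m i) - ε) then 1 else 0 with hQ
  have hP0 : ∀ i E, 0 ≤ P i E := fun i E => by simp only [hP]; split_ifs <;> norm_num
  have hQ0 : ∀ i E, 0 ≤ Q i E := fun i E => by simp only [hQ]; split_ifs <;> norm_num
  have hcent : ∀ i j, |y j - m i| ≤ 2 * C := by
    intro i j
    have h1 : |m i| ≤ C := by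
      simp only [hm]
      rw [abs_div, abs_of_pos hn1, div_le_iff₀ hn1]
      refine (Finset.abs_sum_le_sum_abs _ _).trans ?_
      refine (Finset.sum_le_card_nsmul _ _ C fun j _ => hyC j).trans_eq ?_
      rw [nsmul_eq_mul, card_univ_erase_cast, mul_comm]
    refine (abs_sub _ _).trans ?_
    linarith [hyC j]
  have hsum : ∀ i, ∑ j ∈ Finset.univ.erase i, (y j - m i) = 0 := by
    intro i
    rw [Finset.sum_sub_distrib, Finset.sum_const, nsmul_eq_mul, card_univ_erase_cast]
    simp only [hm]
    field_simp
    ring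
  have hEP := fun i => dExp_sum_outNbrs_nonneg_le hp i (c := fun j => y j - m i)
    (L := 2 * C) (by positivity) hε (hcent i) (hsum i)
  have hEQ := fun i => dExp_sum_outNbrs_nonneg_le hp i (c := fun j => -(y j - m i))
    (L := 2 * C) (by positivity) hε (fun j => by rw [abs_neg]; exact hcent i j)
    (by rw [Finset.sum_neg_distrib, hsum, neg_zero])
  set b := Real.exp (-(p * (n - 1 : ℝ) * (ε ^ 2 / (4 * (2 * C + ε) ^ 2)))) with hb
  calc dExp n p (fun E => ‖(HmatD n α E - completeMat n α) *ᵥ y‖)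
      ≤ dExp n p (fun E => ε + (∑ i, (P i E + Q i E)) * (2 * C)) := by
        refine dExp_mono hp fun E _ => ?_
        have hs0 : 0 ≤ ∑ i, (P i E + Q i E) :=
          Finset.sum_nonneg fun i _ => add_nonneg (hP0 i E) (hQ0 i E)
        refine (pi_norm_le_iff_of_nonneg (by positivity)).2 fun i => ?_
        refine (abs_HmatD_sub_completeMat_mulVec_le hn hα hε hyC E i
          (m := m i) rfl).trans ?_
        have h := Finset.single_le_sum (f := fun i => P i E + Q i E)
          (fun i _ => add_nonneg (hP0 i E) (hQ0 i E)) (Finset.mem_univ i)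
        have h' := mul_le_mul_of_nonneg_left h (by positivity : 0 ≤ 2 * C)
        simp only [hP, hQ] at h' ⊢
        linarith
    _ = ε + (∑ i, (dExp n p (P i) + dExp n p (Q i))) * (2 * C) := by
        rw [dExp_add, dExp_const, dExp_mul_const, dExp_sum]
        simp only [dExp_add]
    _ ≤ ε + (∑ _i : Fin n, (b + b)) * (2 * C) := by
        gcongr with i
        · exact hEP i
        · exact hEQ i
    _ = _ := by
        rw [Finset.sum_const, Finset.card_univ, Fintype.card_fin, nsmul_eq_mul]
        ring

end Concentration

lemma tendsto_nat_mul_exp_neg {p : ℕ → ℝ} (hp : ∀ n, 0 < p n)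
    (hreg : Tendsto (fun n : ℕ => p n / (Real.log n / n)) atTop atTop) {κ : ℝ} (hκ : 0 < κ) :
    Tendsto (fun n : ℕ => n * Real.exp (-(p n * (n - 1 : ℝ) * κ))) atTop (𝓝 0) := by
  refine squeeze_zero' (Eventually.of_forall fun n => by positivity) ?_
    tendsto_inv_atTop_nhds_zero_nat
  filter_upwards [hreg.eventually_ge_atTop (4 / κ), eventually_ge_atTop 2] with n hn hn2
  have hn2' : (2 : ℝ) ≤ n := by exact_mod_cast hn2
  have hn0 : (0 : ℝ) < n := by linarith
  have hlog : 0 < Real.log n := Real.log_pos (by linarith)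
  rw [le_div_iff₀ (by positivity), div_mul_div_comm, div_le_iff₀ (by positivity)] at hn
  have h1 : 2 * Real.log n ≤ p n * (n - 1 : ℝ) * κ := by
    nlinarith [mul_pos (mul_pos (hp n) hκ) hn0, mul_nonneg (mul_pos (hp n) hκ).le
      (sub_nonneg.2 hn2')]
  calc n * Real.exp (-(p n * (n - 1 : ℝ) * κ)) ≤ n * Real.exp (-Real.log n + -Real.log n) :=
        mul_le_mul_of_nonneg_left (Real.exp_le_exp.2 (by linarith)) hn0.le
    _ = (n : ℝ)⁻¹ := by
        rw [Real.exp_add, Real.exp_neg, Real.exp_log hn0]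
        field_simp

/-- Both the expected stable opinion and the mean-field stable opinion are controlled by the
distance of the random dynamics to the dynamics on the complete graph. -/
lemma norm_dExp_sub_mean_field_le {n : ℕ} {p a : ℝ} (hp : p ∈ Set.Ioo (0 : ℝ) 1)
    {H : Finset (Fin n × Fin n) → Matrix (Fin n) (Fin n) ℝ} {M : Matrix (Fin n) (Fin n) ℝ}
    (ha : 0 ≤ a) (ha1 : a < 1) (hH : ∀ E i, ∑ j, |H E i j| ≤ a) {b y : Fin n → ℝ}
    (hy : y = M *ᵥ y + b) :
    ‖(fun i => dExp n p fun E => ((1 - H E)⁻¹ *ᵥ b) i) - (1 - dExpMat n p H)⁻¹ *ᵥ b‖ ≤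
      2 * (dExp n p (fun E => ‖(H E - M) *ᵥ y‖) / (1 - a)) := by
  set D := dExp n p (fun E => ‖(H E - M) *ᵥ y‖) with hD
  have h1 : ‖(fun i => dExp n p fun E => ((1 - H E)⁻¹ *ᵥ b) i) - y‖ ≤ D / (1 - a) := by
    have h : (fun i => dExp n p fun E => ((1 - H E)⁻¹ *ᵥ b) i) - y =
        fun i => dExp n p fun E => (((1 - H E)⁻¹ *ᵥ b) - y : Fin n → ℝ) i := by
      ext i
      simp only [Pi.sub_apply, dExp_sub, dExp_const]
    rw [h, hD, div_eq_mul_inv, ← dExp_mul_const]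
    refine (norm_dExp_le hp _).trans (dExp_mono hp fun E _ => ?_)
    rw [← div_eq_mul_inv]
    exact norm_sub_le_of_fixed_points ha ha1 (hH E) (inv_one_sub_mulVec_eq ha ha1 (hH E) b) hy
  have h2 : ‖(1 - dExpMat n p H)⁻¹ *ᵥ b - y‖ ≤ D / (1 - a) := by
    have hE := dExpMat_row_sum_le hp hH
    refine (norm_sub_le_of_fixed_points ha ha1 hE (inv_one_sub_mulVec_eq ha ha1 hE b) hy).trans ?_
    refine div_le_div_of_nonneg_right ?_ (by linarith)
    have h : (dExpMat n p H - M) *ᵥ y = fun i => dExp n p fun E => ((H E - M) *ᵥ y) i := by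
      ext i
      simp only [Matrix.sub_mulVec, Pi.sub_apply, dExpMat_mulVec, dExp_sub, dExp_const]
    rw [h]
    exact norm_dExp_le hp _
  rw [← sub_sub_sub_cancel_right _ _ y]
  refine (norm_sub_le _ _).trans ?_
  linarith

/-- **Theorem (mean-field concentration, directed model).**
Let `G ∼ D(n,p)` with condescendence parameters `α` and initial opinions
`x0 ∈ [0,1]ⁿ`.  Under the Assumption (there is `ᾱ ∈ (0,1)` with `α n i ≤ ᾱ` for
all `n, i`) and the regime `p ≫ log n / n`, the stable opinion `x(G,∞)` (the
limit of the directed opinion dynamics, which exists for every directed graph)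
satisfies `‖E(x(G,∞)) − x̄(∞)‖_∞ → 0` as `n → ∞`, where
`x̄(∞) = (I − E(H(G)))⁻¹ B x(0)`.  The norm on `Fin n → ℝ` is the sup norm. -/
theorem mean_field_concentration_directed
    (p : ℕ → ℝ) (hp : ∀ n, p n ∈ Set.Ioo (0 : ℝ) 1)
    (α : (n : ℕ) → Fin n → ℝ) (hα : ∀ n i, α n i ∈ Set.Icc (0 : ℝ) 1)
    (x0 : (n : ℕ) → Fin n → ℝ) (hx0 : ∀ n i, x0 n i ∈ Set.Icc (0 : ℝ) 1)
    (hAssumption : ∃ ᾱ ∈ Set.Ioo (0 : ℝ) 1, ∀ n i, α n i ≤ ᾱ)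
    (hreg : Tendsto (fun n : ℕ => p n / (Real.log n / n)) atTop atTop) :
    ∃ xInf : (n : ℕ) → Finset (Fin n × Fin n) → Fin n → ℝ,
      (∀ n, ∀ E ∈ (allDirEdges n).powerset,
        Tendsto
          (fun t => dynD n (HmatD n (α n) E) (Matrix.diagonal fun i => 1 - α n i) (x0 n) t)
          atTop (nhds (xInf n E))) ∧
      Tendsto
        (fun n : ℕ =>
          ‖(fun i => dExp n (p n) fun E => xInf n E i) -
            (1 - dExpMat n (p n) (HmatD n (α n)))⁻¹ *ᵥ
              (Matrix.diagonal (fun i => 1 - α n i) *ᵥ x0 n)‖)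
        atTop (nhds 0) := by
  obtain ⟨a, ⟨ha0, ha1⟩, ha⟩ := hAssumption
  have hrow : ∀ n E i, ∑ j, |HmatD n (α n) E i j| ≤ a := fun n E =>
    HmatD_row_sum_le (fun i => (hα n i).1) (ha n) E
  set b : (n : ℕ) → Fin n → ℝ := fun n => Matrix.diagonal (fun i => 1 - α n i) *ᵥ x0 n with hb
  refine ⟨fun n E => (1 - HmatD n (α n) E)⁻¹ *ᵥ b n, fun n E _ =>
    tendsto_dynD ha0.le ha1 (hrow n E) (inv_one_sub_mulVec_eq ha0.le ha1 (hrow n E) _), ?_⟩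
  have hb1 : ∀ n, ‖b n‖ ≤ 1 := by
    refine fun n => (pi_norm_le_iff_of_nonneg zero_le_one).2 fun i => ?_
    simp only [hb, Matrix.mulVec_diagonal]
    have h1 := hα n i
    have h2 := hx0 n i
    rw [Real.norm_eq_abs, abs_of_nonneg (mul_nonneg (by linarith [h1.2]) h2.1)]
    exact mul_le_one₀ (by linarith [h1.1]) h2.1 h2.2
  have ha1' : 0 < 1 - a := by linarith
  set C := 1 / (1 - a) with hC
  have hC0 : 0 < C := by positivity
  have key : ∀ ε > 0, ∀ n ≥ 2,
      ‖(fun i => dExp n (p n) fun E => ((1 - HmatD n (α n) E)⁻¹ *ᵥ b n) i) -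
        (1 - dExpMat n (p n) (HmatD n (α n)))⁻¹ *ᵥ b n‖ ≤
      2 * ((ε + 4 * C * (n * Real.exp (-(p n * (n - 1 : ℝ) *
        (ε ^ 2 / (4 * (2 * C + ε) ^ 2)))))) / (1 - a)) := by
    intro ε hε n hn
    have hcr := completeMat_row_sum_le hn (fun i => (hα n i).1) (ha n)
    have hy := inv_one_sub_mulVec_eq ha0.le ha1 hcr (b n)
    have hyC := (norm_le_of_eq_mulVec_add ha0.le ha1 hcr hy).trans
      (div_le_div_of_nonneg_right (hb1 n) ha1'.le)
    refine (norm_dExp_sub_mean_field_le (hp n) ha0.le ha1 (hrow n) hy).trans ?_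
    gcongr
    exact dExp_norm_HmatD_sub_completeMat_mulVec_le hn (hp n) (hα n) hC0.le hε hyC
  rw [Metric.tendsto_nhds]
  intro δ hδ
  set ε := δ * (1 - a) / 4 with hε
  have hε0 : 0 < ε := by positivity
  have hlim := ((((tendsto_nat_mul_exp_neg (fun n => (hp n).1) hreg
    (κ := ε ^ 2 / (4 * (2 * C + ε) ^ 2)) (by positivity)).const_mul (4 * C)).const_add
      ε).div_const (1 - a)).const_mul 2
  have hlt : 2 * ((ε + 4 * C * 0) / (1 - a)) < δ := by
    have : 2 * ((ε + 4 * C * 0) / (1 - a)) = δ / 2 := by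
      rw [hε]
      field_simp
      ring
    linarith
  filter_upwards [hlim.eventually_lt_const hlt, eventually_ge_atTop 2] with n h1 h2
  rw [dist_zero_right, norm_norm]
  exact (key ε hε0 n h2).trans_lt h1
end
end
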